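/- Let p ∈ (0, 5) with p ≠ 1, and let R > 0. Then there exists exactly one function u : closure(B_R) → ℝ that is continuous on closure(B_R), twice continuously differentiable and radially symmetric on B_R, positive on B_R, vanishes on ∂B_R, and satisfies the Lane–Emden equation Δu + 4π u^p = 0 on B_R. -/

import Mathlib

open MeasureTheory Real

/-- The Laplacian on `ℝ³`: sum of the pure second directional derivatives along the
standard orthonormal basis. -/
noncomputable def lap (u : EuclideanSpace ℝ (Fin 3) → ℝ) (x : EuclideanSpace ℝ (Fin 3)) : ℝ :=
  ∑ i : Fin 3, iteratedFDeriv ℝ 2 u x ![EuclideanSpace.single i 1, EuclideanSpace.single i 1]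

/-- `u` is a positive radial Dirichlet solution of the Lane–Emden equation
`Δu + 4π u^p = 0` on the ball of radius `R`: continuous up to the closed ball,
`C²` and radially symmetric and positive inside, vanishing on the boundary sphere. -/
def IsLaneEmdenSolution (p R : ℝ) (u : EuclideanSpace ℝ (Fin 3) → ℝ) : Prop :=
  ContinuousOn u (closure (Metric.ball (0 : EuclideanSpace ℝ (Fin 3)) R)) ∧
  ContDiffOn ℝ 2 u (Metric.ball (0 : EuclideanSpace ℝ (Fin 3)) R) ∧
  (∀ x ∈ Metric.ball (0 : EuclideanSpace ℝ (Fin 3)) R,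
    ∀ y ∈ Metric.ball (0 : EuclideanSpace ℝ (Fin 3)) R, ‖x‖ = ‖y‖ → u x = u y) ∧
  (∀ x ∈ Metric.ball (0 : EuclideanSpace ℝ (Fin 3)) R, 0 < u x) ∧
  (∀ x ∈ Metric.sphere (0 : EuclideanSpace ℝ (Fin 3)) R, u x = 0) ∧
  (∀ x ∈ Metric.ball (0 : EuclideanSpace ℝ (Fin 3)) R, lap u x + 4 * π * u x ^ p = 0)

open Set Filter Topology
open scoped NNReal

/-- `f` is a positive radial profile on `[0, T)` of the Lane–Emden equation, written as a
first-order system for `r * f r` and its derivative `g`. -/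
structure IsRadialProfile (p T : ℝ) (f g : ℝ → ℝ) : Prop where
  cont_f : ContinuousOn f (Ico 0 T)
  cont_g : ContinuousOn g (Ico 0 T)
  pos : ∀ r ∈ Ico 0 T, 0 < f r
  zero : g 0 = f 0
  deriv_f : ∀ r ∈ Ioo 0 T, HasDerivAt f ((g r - f r) / r) r
  deriv_g : ∀ r ∈ Ioo 0 T, HasDerivAt g (-(4 * π * r * f r ^ p)) r

theorem antitoneOn_Ico_of_hasDerivAt_nonpos {T : ℝ} {h h' : ℝ → ℝ}
    (hc : ContinuousOn h (Ico 0 T)) (hd : ∀ r ∈ Ioo 0 T, HasDerivAt h (h' r) r)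
    (hn : ∀ r ∈ Ioo 0 T, h' r ≤ 0) : AntitoneOn h (Ico 0 T) := by
  refine antitoneOn_of_hasDerivWithinAt_nonpos (convex_Ico 0 T) (f' := h') hc ?_ ?_
  · rw [interior_Ico]
    exact fun r hr => (hd r hr).hasDerivWithinAt
  · rwa [interior_Ico]

theorem exists_lipschitzOnWith_rpow (p : ℝ) {ε M : ℝ} (hε : 0 < ε) :
    ∃ K : ℝ≥0, LipschitzOnWith K (fun x : ℝ => x ^ p) (Icc ε M) := by
  have hd : ∀ x ∈ Icc ε M, HasDerivAt (fun x : ℝ => x ^ p) (p * x ^ (p - 1)) x := fun x hx =>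
    Real.hasDerivAt_rpow_const (Or.inl (hε.trans_le hx.1).ne')
  have hc : ContinuousOn (fun x : ℝ => p * x ^ (p - 1)) (Icc ε M) :=
    continuousOn_const.mul (continuousOn_id.rpow_const
      fun x hx => Or.inl (hε.trans_le hx.1).ne')
  obtain ⟨C, hC⟩ := isCompact_Icc.exists_bound_of_continuousOn hc
  refine ⟨C.toNNReal, (convex_Icc ε M).lipschitzOnWith_of_nnnorm_hasDerivWithin_le
    (fun x hx => (hd x hx).hasDerivWithinAt) fun x hx => ?_⟩
  rw [← NNReal.coe_le_coe, coe_nnnorm]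
  exact (hC x hx).trans (Real.le_coe_toNNReal C)

namespace IsRadialProfile

variable {p T : ℝ} {f g : ℝ → ℝ}

theorem mono (h : IsRadialProfile p T f g) {S : ℝ} (hS : S ≤ T) : IsRadialProfile p S f g where
  cont_f := h.cont_f.mono (Ico_subset_Ico_right hS)
  cont_g := h.cont_g.mono (Ico_subset_Ico_right hS)
  pos r hr := h.pos r (Ico_subset_Ico_right hS hr)
  zero := h.zero
  deriv_f r hr := h.deriv_f r (Ioo_subset_Ioo_right hS hr)
  deriv_g r hr := h.deriv_g r (Ioo_subset_Ioo_right hS hr)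

theorem congr (h : IsRadialProfile p T f g) (hT : 0 < T) {f₁ g₁ : ℝ → ℝ}
    (hf : EqOn f₁ f (Ico 0 T)) (hg : EqOn g₁ g (Ico 0 T)) : IsRadialProfile p T f₁ g₁ where
  cont_f := h.cont_f.congr hf
  cont_g := h.cont_g.congr hg
  pos r hr := hf hr ▸ h.pos r hr
  zero := by rw [hf ⟨le_rfl, hT⟩, hg ⟨le_rfl, hT⟩, h.zero]
  deriv_f r hr := by
    have hr' := Ioo_subset_Ico_self hr
    rw [hf hr', hg hr']
    exact (h.deriv_f r hr).congr_of_eventuallyEq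
      (Filter.eventuallyEq_of_mem (Ico_mem_nhds hr.1 hr.2) hf)
  deriv_g r hr := by
    have hr' := Ioo_subset_Ico_self hr
    rw [hf hr']
    exact (h.deriv_g r hr).congr_of_eventuallyEq
      (Filter.eventuallyEq_of_mem (Ico_mem_nhds hr.1 hr.2) hg)

theorem cont_flux (h : IsRadialProfile p T f g) :
    ContinuousOn (fun r => r * (g r - f r)) (Ico 0 T) :=
  continuousOn_id.mul (h.cont_g.sub h.cont_f)

theorem deriv_mul (h : IsRadialProfile p T f g) {r : ℝ} (hr : r ∈ Ioo 0 T) :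
    HasDerivAt (fun r => r * f r) (g r) r := by
  have := (hasDerivAt_id r).mul (h.deriv_f r hr)
  have h0 : r ≠ 0 := hr.1.ne'
  convert! this using 1
  simp only [id]
  field_simp
  ring

theorem deriv_flux (h : IsRadialProfile p T f g) {r : ℝ} (hr : r ∈ Ioo 0 T) :
    HasDerivAt (fun r => r * (g r - f r)) (-(4 * π * r ^ 2 * f r ^ p)) r := by
  have := ((hasDerivAt_id r).mul (h.deriv_g r hr)).sub (h.deriv_mul hr)
  convert! this using 1
  · ext s; simp; ring
  · simp only [id]; ring

theorem rpow_pos (h : IsRadialProfile p T f g) {r : ℝ} (hr : r ∈ Ico 0 T) : 0 < f r ^ p :=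
  Real.rpow_pos_of_pos (h.pos r hr) p

theorem flux_nonpos (h : IsRadialProfile p T f g) {r : ℝ} (hr : r ∈ Ico 0 T) :
    r * (g r - f r) ≤ 0 := by
  have := antitoneOn_Ico_of_hasDerivAt_nonpos h.cont_flux (fun r hr => h.deriv_flux hr)
    (fun r hr => by
      have := h.rpow_pos (Ioo_subset_Ico_self hr)
      have := pi_pos
      rw [neg_nonpos]; positivity) ⟨le_rfl, hr.1.trans_lt hr.2⟩ hr hr.1
  simpa using this

theorem g_le_f (h : IsRadialProfile p T f g) {r : ℝ} (hr : r ∈ Ico 0 T) : g r ≤ f r := by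
  rcases hr.1.eq_or_lt with h0 | h0
  · rw [← h0, h.zero]
  · have := h.flux_nonpos hr
    nlinarith

theorem antitoneOn (h : IsRadialProfile p T f g) : AntitoneOn f (Ico 0 T) :=
  antitoneOn_Ico_of_hasDerivAt_nonpos h.cont_f h.deriv_f fun r hr =>
    div_nonpos_of_nonpos_of_nonneg (by linarith [h.g_le_f (Ioo_subset_Ico_self hr)]) hr.1.le

/-- The radial profile solves the (one-sided) initial value problem of a regular system. -/
theorem hasDerivWithinAt_system (h : IsRadialProfile p T f g) (hp : 0 < p) {r : ℝ}
    (hr : r ∈ Ico 0 T) :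
    HasDerivWithinAt (fun r => (r * f r, g r)) (g r, -(4 * π * r * (r * f r / r) ^ p)) (Ici r) r := by
  rcases hr.1.eq_or_lt with rfl | h0
  · have hT : (0 : ℝ) < T := hr.2
    have hIoo : Ioo 0 T ∈ 𝓝[>] (0 : ℝ) := Ioo_mem_nhdsGT hT
    have hc {k : ℝ → ℝ} (hk : ContinuousOn k (Ico 0 T)) : Tendsto k (𝓝[>] 0) (𝓝 (k 0)) :=
      ((hk 0 hr).mono_of_mem_nhdsWithin (mem_of_superset hIoo Ioo_subset_Ico_self)).tendsto
    refine HasDerivWithinAt.prodMk ?_ ?_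
    · refine hasDerivWithinAt_Ici_of_tendsto_deriv (s := Ioo 0 T)
        (fun r hr => (h.deriv_mul hr).differentiableAt.differentiableWithinAt)
        (((continuousOn_id.mul h.cont_f) 0 hr).mono Ioo_subset_Ico_self) hIoo ?_
      refine (hc h.cont_g).congr' ?_
      filter_upwards [hIoo] with r hr using (h.deriv_mul hr).deriv.symm
    · refine hasDerivWithinAt_Ici_of_tendsto_deriv (s := Ioo 0 T)
        (fun r hr => (h.deriv_g r hr).differentiableAt.differentiableWithinAt)
        ((h.cont_g 0 hr).mono Ioo_subset_Ico_self) hIoo ?_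
      have hk : ContinuousOn (fun r => -(4 * π * r * f r ^ p)) (Ico 0 T) :=
        ((continuousOn_const.mul continuousOn_id).mul
          (h.cont_f.rpow_const fun r _ => Or.inr hp.le)).neg
      have := hc hk
      simp only [mul_zero, zero_mul, neg_zero] at this ⊢
      refine this.congr' ?_
      filter_upwards [hIoo] with r hr using (h.deriv_g r hr).deriv.symm
  · rw [mul_div_cancel_left₀ _ h0.ne']
    exact ((h.deriv_mul ⟨h0, hr.2⟩).prodMk (h.deriv_g r ⟨h0, hr.2⟩)).hasDerivWithinAt

theorem lipschitzOnWith_system {p ε M : ℝ} {K : ℝ≥0}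
    (hK : LipschitzOnWith K (fun x : ℝ => x ^ p) (Icc ε M)) {t : ℝ} (ht : 0 ≤ t) :
    LipschitzOnWith (max 1 (4 * π * K).toNNReal)
      (fun x : ℝ × ℝ => (x.2, -(4 * π * t * (x.1 / t) ^ p)))
      {x : ℝ × ℝ | ε * t ≤ x.1 ∧ x.1 ≤ M * t} := by
  refine LipschitzOnWith.prodMk (LipschitzWith.prod_snd.lipschitzOnWith) ?_
  refine LipschitzOnWith.of_dist_le_mul fun x hx y hy => ?_
  rcases ht.eq_or_lt with rfl | h0
  · simp; positivity
  have h1 := hK.dist_le_mul (x.1 / t) ⟨(le_div_iff₀ h0).2 hx.1, (div_le_iff₀ h0).2 hx.2⟩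
    (y.1 / t) ⟨(le_div_iff₀ h0).2 hy.1, (div_le_iff₀ h0).2 hy.2⟩
  have h2 : dist (x.1 / t) (y.1 / t) = dist x.1 y.1 / t := by
    rw [Real.dist_eq, Real.dist_eq, ← sub_div, abs_div, abs_of_pos h0]
  have h3 : dist x.1 y.1 ≤ dist x y := le_max_left _ _
  rw [h2] at h1
  have h4 : dist (-(4 * π * t * (x.1 / t) ^ p)) (-(4 * π * t * (y.1 / t) ^ p))
      = 4 * π * t * dist ((x.1 / t) ^ p) ((y.1 / t) ^ p) := by
    rw [dist_neg_neg, Real.dist_eq, Real.dist_eq, ← mul_sub, abs_mul,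
      abs_of_pos (by positivity : 0 < 4 * π * t)]
  rw [h4, Real.coe_toNNReal _ (by positivity)]
  calc 4 * π * t * dist ((x.1 / t) ^ p) ((y.1 / t) ^ p)
      ≤ 4 * π * t * (K * (dist x.1 y.1 / t)) := by gcongr
    _ = 4 * π * K * dist x.1 y.1 := by field_simp
    _ ≤ 4 * π * K * dist x y := by gcongr

theorem eqOn (hp : 0 < p) (h : IsRadialProfile p T f g) {f₁ g₁ : ℝ → ℝ}
    (h₁ : IsRadialProfile p T f₁ g₁) (h0 : f₁ 0 = f 0) :
    EqOn f₁ f (Ico 0 T) ∧ EqOn g₁ g (Ico 0 T) := by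
  suffices H : ∀ b ∈ Ico 0 T, f₁ b = f b ∧ g₁ b = g b from
    ⟨fun b hb => (H b hb).1, fun b hb => (H b hb).2⟩
  intro b hb
  rcases hb.1.eq_or_lt with rfl | hb0
  · exact ⟨h0, by rw [h.zero, h₁.zero, h0]⟩
  have hsub : Icc 0 b ⊆ Ico 0 T := fun x hx => ⟨hx.1, hx.2.trans_lt hb.2⟩
  have hsub' : Ico 0 b ⊆ Ico 0 T := Ico_subset_Ico_right hb.2.le
  have hz : (0 : ℝ) ∈ Ico 0 T := ⟨le_rfl, hb.1.trans_lt hb.2⟩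
  set ε := min (f b) (f₁ b)
  have hε : 0 < ε := lt_min (h.pos b hb) (h₁.pos b hb)
  obtain ⟨K, hK⟩ := exists_lipschitzOnWith_rpow p (M := f 0) hε
  have bound {k l : ℝ → ℝ} (hk : IsRadialProfile p T k l) (hk0 : k 0 = f 0) (hkε : ε ≤ k b) :
      ∀ t ∈ Ico 0 b, (t * k t, l t) ∈ {x : ℝ × ℝ | ε * t ≤ x.1 ∧ x.1 ≤ f 0 * t} := by
    intro t ht
    have h1 := hk.antitoneOn (hsub' ht) hb ht.2.le
    have h2 := hk.antitoneOn hz (hsub' ht) ht.1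
    simp only [mem_ofPred_eq]
    constructor
    · nlinarith [ht.1]
    · nlinarith [ht.1]
  have cont {k l : ℝ → ℝ} (hk : IsRadialProfile p T k l) :
      ContinuousOn (fun r => (r * k r, l r)) (Icc 0 b) :=
    (continuousOn_id.mul (hk.cont_f.mono hsub)).prodMk (hk.cont_g.mono hsub)
  have := ODE_solution_unique_of_mem_Icc_right
    (v := fun t x => (x.2, -(4 * π * t * (x.1 / t) ^ p)))
    (s := fun t => {x : ℝ × ℝ | ε * t ≤ x.1 ∧ x.1 ≤ f 0 * t})
    (fun t ht => lipschitzOnWith_system hK ht.1)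
    (cont h₁) (fun t ht => h₁.hasDerivWithinAt_system hp (hsub' ht))
    (bound h₁ h0 (min_le_right _ _))
    (cont h) (fun t ht => h.hasDerivWithinAt_system hp (hsub' ht))
    (bound h rfl (min_le_left _ _))
    (by simp [h.zero, h₁.zero, h0]) ⟨hb.1, le_rfl⟩
  simp only [Prod.mk.injEq, mul_eq_mul_left_iff, hb0.ne', or_false] at this
  exact this

end IsRadialProfile

theorem continuousOn_Ici_of_forall_Ico {k : ℝ → ℝ} (hk : ∀ T, ContinuousOn k (Ico 0 T)) :
    ContinuousOn k (Ici 0) := fun r hr =>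
  (hk (r + 1) r ⟨hr, lt_add_one r⟩).mono_of_mem_nhdsWithin
    (mem_nhdsWithin.2 ⟨Iio (r + 1), isOpen_Iio, lt_add_one r, fun _ hx => ⟨hx.2, hx.1⟩⟩)

namespace IsRadialProfile

theorem nonneg_g_of_global {p : ℝ} {f g : ℝ → ℝ} (h : ∀ T, IsRadialProfile p T f g)
    {r : ℝ} (hr : 0 < r) : 0 ≤ g r := by
  by_contra! hg
  have hf : 0 < f r := (h (r + 1)).pos r ⟨hr.le, by linarith⟩
  set s := r + r * f r / (-g r) with hs
  have hrs : r < s := by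
    have : 0 < r * f r / (-g r) := by have := neg_pos.2 hg; positivity
    linarith
  have hfs : 0 < f s := (h (s + 1)).pos s ⟨by linarith, by linarith⟩
  have hd : ∀ x ∈ Icc r s, HasDerivAt (fun r => r * f r) (g x) x := fun x hx =>
    (h (x + 1)).deriv_mul ⟨hr.trans_le hx.1, by linarith⟩
  obtain ⟨c, hc, hcs⟩ := exists_hasDerivAt_eq_slope (fun r => r * f r) g hrs
    (fun x hx => (hd x hx).continuousAt.continuousWithinAt)
    (fun x hx => hd x (Ioo_subset_Icc_self hx))
  have hgc : g c ≤ g r := by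
    refine antitoneOn_Ico_of_hasDerivAt_nonpos (h (c + 1)).cont_g (h (c + 1)).deriv_g
      (fun x hx => ?_) ⟨hr.le, by linarith [hc.1]⟩ ⟨by linarith [hc.1], by linarith⟩ hc.1.le
    have := (h (c + 1)).rpow_pos (Ioo_subset_Ico_self hx)
    have := hx.1
    have := pi_pos
    rw [neg_nonpos]; positivity
  rw [eq_div_iff (by linarith)] at hcs
  have h1 : g r * (s - r) = -(r * f r) := by
    rw [hs]; field_simp [hg.ne]; ring
  have h2 : g c * (s - r) ≤ g r * (s - r) := by gcongr
  have h3 : 0 < s * f s := mul_pos (hr.trans hrs) hfs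
  linarith

theorem flux_le_of_global {p : ℝ} (hp : 0 < p) {f g : ℝ → ℝ} (h : ∀ T, IsRadialProfile p T f g)
    {r : ℝ} (hr : 0 < r) : r * (g r - f r) ≤ -(4 * π / 3 * r ^ 3 * f r ^ p) := by
  have hT := h (r + 1)
  have hsub : Icc 0 r ⊆ Ico 0 (r + 1) := fun x hx => ⟨hx.1, by linarith [hx.2]⟩
  have := antitoneOn_of_hasDerivWithinAt_nonpos (convex_Icc 0 r)
    (f := fun s => s * (g s - f s) + 4 * π / 3 * f r ^ p * s ^ 3)
    (f' := fun s => -(4 * π * s ^ 2 * f s ^ p) + 4 * π / 3 * f r ^ p * (3 * s ^ 2))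
    ((hT.cont_flux.mono hsub).add (by fun_prop))
    (fun s hs => by
      rw [interior_Icc] at hs
      have h3 := ((hasDerivAt_pow 3 s).const_mul (4 * π / 3 * f r ^ p))
      exact ((hT.deriv_flux ⟨hs.1, by linarith [hs.2]⟩).add (by simpa using h3)).hasDerivWithinAt)
    (fun s hs => by
      rw [interior_Icc] at hs
      have h1 : f r ^ p ≤ f s ^ p := by
        have h0 := hT.pos r ⟨hr.le, by linarith⟩
        have := hT.antitoneOn (hsub (Ioo_subset_Icc_self hs)) (hsub ⟨hr.le, le_rfl⟩) hs.2.le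
        gcongr
      have h2 : 4 * π * s ^ 2 * f r ^ p ≤ 4 * π * s ^ 2 * f s ^ p := by gcongr
      linarith)
    (left_mem_Icc.2 hr.le) (right_mem_Icc.2 hr.le) hr.le
  simp only [zero_mul] at this
  norm_num at this
  linarith

/-- The Pohozaev functional of a global profile is strictly increasing for `p < 5`. -/
theorem strictMonoOn_pohozaev {p : ℝ} (hp : 0 < p) (hp5 : p < 5) {f g : ℝ → ℝ}
    (h : ∀ T, IsRadialProfile p T f g) :
    StrictMonoOn (fun r => 1 / 2 * (g r * (r * (g r - f r)))
      + 4 * π / (p + 1) * (r ^ 3 * f r ^ (p + 1))) (Ici 0) := by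
  have hcf := continuousOn_Ici_of_forall_Ico fun T => (h T).cont_f
  have hcg := continuousOn_Ici_of_forall_Ico fun T => (h T).cont_g
  refine strictMonoOn_of_hasDerivWithinAt_pos (convex_Ici 0)
    (f' := fun r => 2 * π * (5 - p) / (p + 1) * (r ^ 2 * f r ^ (p + 1))) ?_ ?_ ?_
  · have : ContinuousOn (fun r => f r ^ (p + 1)) (Ici 0) :=
      hcf.rpow_const fun r _ => Or.inr (by linarith)
    fun_prop
  · intro r hr
    rw [interior_Ici] at hr ⊢
    have hr0 : (0 : ℝ) < r := hr
    have hT := h (r + 1)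
    have hrT : r ∈ Ioo 0 (r + 1) := ⟨hr, by linarith⟩
    have hf : 0 < f r := hT.pos r ⟨hr0.le, by linarith⟩
    have h1 := ((hT.deriv_g r hrT).mul (hT.deriv_flux hrT)).const_mul (1 / 2)
    have h2 := ((hasDerivAt_pow 3 r).mul ((hT.deriv_f r hrT).rpow_const (p := p + 1)
      (Or.inl hf.ne'))).const_mul (4 * π / (p + 1))
    refine HasDerivAt.hasDerivWithinAt ?_
    convert! h1.add h2 using 1
    rw [add_sub_cancel_right, Real.rpow_add_one hf.ne']
    have : p + 1 ≠ 0 := by linarith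
    push_cast
    field_simp
    ring
  · intro r hr
    rw [interior_Ici] at hr
    have hr0 : (0 : ℝ) < r := hr
    have hf : 0 < f r ^ (p + 1) :=
      Real.rpow_pos_of_pos ((h (r + 1)).pos r ⟨hr0.le, by linarith⟩) _
    have := pi_pos
    have : 0 < 5 - p := by linarith
    positivity

theorem not_global {p : ℝ} (hp : 0 < p) (hp5 : p < 5) {f g : ℝ → ℝ}
    (h : ∀ T, IsRadialProfile p T f g) : False := by
  have hpi := pi_pos
  have hfpos : ∀ r, 0 ≤ r → 0 < f r := fun r hr => (h (r + 1)).pos r ⟨hr, by linarith⟩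
  have hmono := strictMonoOn_pohozaev hp hp5 h
  set P := fun r => 1 / 2 * (g r * (r * (g r - f r))) + 4 * π / (p + 1) * (r ^ 3 * f r ^ (p + 1))
    with hP
  have hP1 : 0 < P 1 := by
    have := hmono (a := 0) self_mem_Ici (b := 1) (by simp) one_pos
    simpa [hP] using this
  have upper : ∀ r, 0 < r → log (4 * π / 3) + 2 * log r + p * log (f r) ≤ log (f r) := by
    intro r hr
    have h1 := flux_le_of_global hp h hr
    have h2 := nonneg_g_of_global h hr
    have hf := hfpos r hr.le
    have h3 : 4 * π / 3 * r ^ 2 * f r ^ p ≤ f r := by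
      have : r * (4 * π / 3 * r ^ 2 * f r ^ p) ≤ r * f r := by nlinarith
      exact le_of_mul_le_mul_left this hr
    have h4 := Real.log_le_log (by positivity) h3
    rwa [log_mul (by positivity) (by positivity), log_mul (by positivity) (by positivity),
      log_pow, log_rpow hf] at h4
  have lower : ∀ r, 1 ≤ r →
      log (P 1) ≤ log (4 * π / (p + 1)) + (3 * log r + (p + 1) * log (f r)) := by
    intro r hr
    have hr0 : 0 < r := by linarith
    have hf := hfpos r hr0.le
    have h1 : P 1 ≤ P r := hmono.monotoneOn (by simp) hr0.le hr
    have h2 : g r * (r * (g r - f r)) ≤ 0 := mul_nonpos_of_nonneg_of_nonpos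
      (nonneg_g_of_global h hr0) ((h (r + 1)).flux_nonpos ⟨hr0.le, by linarith⟩)
    have h3 : P 1 ≤ 4 * π / (p + 1) * (r ^ 3 * f r ^ (p + 1)) := by
      simp only [hP] at h1 ⊢
      linarith
    have h4 := Real.log_le_log hP1 h3
    rwa [log_mul (by positivity) (by positivity), log_mul (by positivity) (by positivity),
      log_pow, log_rpow hf] at h4
  rcases le_or_gt p 1 with hp1 | hp1
  · set L := |log (4 * π / 3)| + |(1 - p) * log (f 0)| + 1
    have h1 := upper (exp L) (exp_pos L)
    rw [log_exp] at h1
    have h2 : log (f (exp L)) ≤ log (f 0) := Real.log_le_log (hfpos _ (exp_pos L).le)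
      ((h (exp L + 1)).antitoneOn ⟨le_rfl, by positivity⟩ ⟨(exp_pos L).le, by linarith⟩
        (exp_pos L).le)
    have h3 : (1 - p) * log (f (exp L)) ≤ (1 - p) * log (f 0) :=
      mul_le_mul_of_nonneg_left h2 (by linarith)
    have h4 := neg_abs_le (log (4 * π / 3))
    have h5 := le_abs_self ((1 - p) * log (f 0))
    have h6 : |log (4 * π / 3)| + |(1 - p) * log (f 0)| + 1 = L := rfl
    have h7 := abs_nonneg (log (4 * π / 3))
    have h8 := abs_nonneg ((1 - p) * log (f 0))
    linarith
  · set A := -((p + 1) * log (4 * π / 3)) + (p - 1) * (log (4 * π / (p + 1)) - log (P 1))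
    set L := (|A| + 1) / (5 - p)
    have h5p : 0 < 5 - p := by linarith
    have hL : 0 ≤ L := by positivity
    have h1 := upper (exp L) (exp_pos L)
    have h2 := lower (exp L) (one_le_exp hL)
    rw [log_exp] at h1 h2
    have h3 : (5 - p) * L = |A| + 1 := mul_div_cancel₀ _ h5p.ne'
    have h4 := le_abs_self A
    have h5 : A = -((p + 1) * log (4 * π / 3)) + (p - 1) * (log (4 * π / (p + 1)) - log (P 1)) := rfl
    have h6 := mul_le_mul_of_nonneg_left h1 (by linarith : 0 ≤ p + 1)
    have h7 := mul_le_mul_of_nonneg_left h2 (by linarith : 0 ≤ p - 1)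
    nlinarith

end IsRadialProfile

theorem exists_lipschitzWith_clamp_rpow (p : ℝ) {η : ℝ} (hη : 0 < η) (hη1 : η ≤ 1) :
    ∃ K : ℝ≥0, LipschitzWith K (fun x : ℝ => (max η (min x 1)) ^ p) := by
  obtain ⟨K, hK⟩ := exists_lipschitzOnWith_rpow p (M := 1) hη
  have h1 : LipschitzWith 1 (fun x : ℝ => max η (min x 1)) :=
    (LipschitzWith.id.min_const 1).const_max η
  refine ⟨K * 1, lipschitzOnWith_univ.1 (hK.comp h1.lipschitzOnWith fun x _ => ?_)⟩
  exact ⟨le_max_left _ _, max_le hη1 (min_le_right _ _)⟩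

/-- Solvability of the radial system with a bounded Lipschitz nonlinearity `G`. -/
theorem exists_solution_of_lipschitz {G : ℝ → ℝ} {K : ℝ≥0} (hG : LipschitzWith K G)
    (hG0 : ∀ x, 0 ≤ G x) (hG1 : ∀ x, G x ≤ 1) {T : ℝ} (hT : 0 < T) :
    ∃ w v : ℝ → ℝ, w 0 = 0 ∧ v 0 = 1 ∧ ∀ t ∈ Icc 0 T,
      HasDerivWithinAt w (v t) (Icc 0 T) t ∧
      HasDerivWithinAt v (-(4 * π * t * G (w t / t))) (Icc 0 T) t := by
  have hpi := pi_pos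
  set C : ℝ := 1 + 4 * π * T * T with hC
  have hC1 : 1 ≤ C := by have : 0 ≤ 4 * π * T * T := by positivity
                         linarith
  set V : ℝ → ℝ × ℝ → ℝ × ℝ := fun t x => (max (-C) (min x.2 C), -(4 * π * t * G (x.1 / t)))
  set L : ℝ≥0 := (max C (4 * π * T)).toNNReal
  have hV2 : ∀ t ∈ Icc 0 T, ∀ x, |-(4 * π * t * G x)| ≤ 4 * π * T := by
    intro t ht x
    rw [abs_neg, abs_of_nonneg (mul_nonneg (by have := ht.1; positivity) (hG0 x))]
    calc 4 * π * t * G x ≤ 4 * π * T * 1 := by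
          gcongr
          · exact hG0 x
          · exact ht.2
          · exact hG1 x
      _ = 4 * π * T := mul_one _
  have hPL : IsPicardLindelof V (tmin := 0) (tmax := T) ⟨0, le_rfl, hT.le⟩ ((0, 1) : ℝ × ℝ)
      (L * T.toNNReal) 0 L (max 1 (4 * π * K).toNNReal) := by
    refine ⟨fun t ht => ?_, fun x _ => ?_, fun t ht x _ => ?_, ?_⟩
    · refine LipschitzOnWith.prodMk
        (((LipschitzWith.prod_snd.min_const C).const_max (-C)).lipschitzOnWith) ?_
      refine LipschitzOnWith.of_dist_le_mul fun x _ y _ => ?_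
      rcases ht.1.eq_or_lt with rfl | h0
      · simp; positivity
      have h1 := hG.dist_le_mul (x.1 / t) (y.1 / t)
      have h2 : dist (x.1 / t) (y.1 / t) = dist x.1 y.1 / t := by
        rw [Real.dist_eq, Real.dist_eq, ← sub_div, abs_div, abs_of_pos h0]
      have h3 : dist x.1 y.1 ≤ dist x y := le_max_left _ _
      rw [h2] at h1
      rw [dist_neg_neg, Real.dist_eq, ← mul_sub, abs_mul,
        abs_of_pos (by positivity : 0 < 4 * π * t), ← Real.dist_eq,
        Real.coe_toNNReal _ (by positivity)]
      calc 4 * π * t * dist (G (x.1 / t)) (G (y.1 / t))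
          ≤ 4 * π * t * (K * (dist x.1 y.1 / t)) := by gcongr
        _ = 4 * π * K * dist x.1 y.1 := by field_simp
        _ ≤ 4 * π * K * dist x y := by gcongr
    · refine continuousOn_const.prodMk (fun t ht => ?_)
      rcases ht.1.eq_or_lt with rfl | h0
      · have : ContinuousAt (fun t => -(4 * π * t * G (x.1 / t))) 0 := by
          have hb : ∀ t : ℝ, ‖-(4 * π * t * G (x.1 / t))‖ ≤ 4 * π * |t| := fun t => by
            rw [norm_neg, Real.norm_eq_abs, abs_mul, abs_mul, abs_of_nonneg (hG0 _),
              abs_of_pos (by positivity : 0 < 4 * π)]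
            exact mul_le_of_le_one_right (by positivity) (hG1 _)
          have hl : Tendsto (fun t : ℝ => 4 * π * |t|) (𝓝 0) (𝓝 0) := by
            have : Continuous (fun t : ℝ => 4 * π * |t|) := by fun_prop
            simpa using this.tendsto 0
          have := squeeze_zero_norm hb hl
          simpa [ContinuousAt] using this
        exact this.continuousWithinAt
      · have hGc := hG.continuous
        have : ContinuousAt (fun t => -(4 * π * t * G (x.1 / t))) t := by
          have : ContinuousAt (fun t => x.1 / t) t := continuousAt_const.div continuousAt_id h0.ne'
          have := hGc.continuousAt.comp this
          exact ((continuousAt_const.mul continuousAt_id).mul this).neg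
        exact this.continuousWithinAt
    · rw [Real.coe_toNNReal _ (by positivity)]
      refine norm_prod_le_iff.2 ⟨?_, (hV2 t ht _).trans (le_max_right _ _)⟩
      refine le_trans ?_ (le_max_left _ _)
      rw [Real.norm_eq_abs, abs_le]
      exact ⟨le_max_left _ _, max_le (by linarith) (min_le_right _ _)⟩
    · simp [hT.le]
  obtain ⟨α, hα0, hα⟩ := hPL.exists_eq_forall_mem_Icc_hasDerivWithinAt₀
  have hd2 : ∀ t ∈ Icc 0 T, HasDerivWithinAt (fun t => (α t).2)
      (-(4 * π * t * G ((α t).1 / t))) (Icc 0 T) t := fun t ht => (hα t ht).snd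
  have hz : (0 : ℝ) ∈ Icc 0 T := ⟨le_rfl, hT.le⟩
  have hbound : ∀ t ∈ Icc 0 T, |(α t).2 - 1| ≤ 4 * π * T * T := by
    intro t ht
    have := (convex_Icc 0 T).norm_image_sub_le_of_norm_hasDerivWithin_le hd2
      (fun t ht => hV2 t ht _) hz ht
    simp only [hα0] at this
    refine this.trans ?_
    rw [sub_zero, Real.norm_eq_abs, abs_of_nonneg ht.1]
    have := ht.2
    gcongr
  refine ⟨fun t => (α t).1, fun t => (α t).2, by simp [hα0], by simp [hα0],
    fun t ht => ⟨?_, hd2 t ht⟩⟩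
  have h1 := abs_le.1 (hbound t ht)
  have h2 : max (-C) (min (α t).2 C) = (α t).2 := by
    rw [min_eq_left (by linarith), max_eq_right (by linarith)]
  have h3 := (hα t ht).fst
  simp only [V, h2] at h3
  exact h3

namespace IsRadialProfile

theorem exists_lt {p : ℝ} (hp : 0 < p) {ε : ℝ} (hε : 0 < ε) (hε1 : ε ≤ 1) :
    ∃ T f g, 0 < T ∧ IsRadialProfile p T f g ∧ f 0 = 1 ∧ ∃ s ∈ Ico 0 T, f s < ε := by
  have hpi := pi_pos
  set η := ε / 2 with hηdef
  have hη : 0 < η := by positivity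
  have hη1 : η < 1 := by linarith
  have hηε : η < ε := by linarith
  set G : ℝ → ℝ := fun x => (max η (min x 1)) ^ p
  obtain ⟨K, hK⟩ := exists_lipschitzWith_clamp_rpow p hη hη1.le
  have hGη : ∀ x, η ^ p ≤ G x := fun x =>
    Real.rpow_le_rpow hη.le (le_max_left _ _) hp.le
  have hηp : 0 < η ^ p := Real.rpow_pos_of_pos hη p
  set c := 2 * π / 3 * η ^ p with hc
  have hc0 : 0 < c := by positivity
  set T := 1 + 1 / c
  have hT : 0 < T := by positivity
  have hT1 : 1 ≤ T := by have : 0 < 1 / c := by positivity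
                         linarith
  obtain ⟨w, v, hw0, hv0, hwv⟩ := exists_solution_of_lipschitz hK
    (fun x => hηp.le.trans (hGη x))
    (fun x => Real.rpow_le_one (hη.le.trans (le_max_left _ _))
      (max_le hη1.le (min_le_right _ _)) hp.le) hT
  set f : ℝ → ℝ := Function.update (fun t => w t / t) 0 1 with hf
  have hf0 : f 0 = 1 := Function.update_self ..
  have hft : ∀ t, 0 < t → f t = w t / t := fun t ht => Function.update_of_ne ht.ne' ..
  have hz : (0 : ℝ) ∈ Icc 0 T := ⟨le_rfl, hT.le⟩
  have hcv : ContinuousOn v (Icc 0 T) := fun t ht => (hwv t ht).2.continuousWithinAt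
  have hcf : ContinuousOn f (Icc 0 T) := by
    intro t ht
    rcases ht.1.eq_or_lt with rfl | h0
    · rw [hf, continuousWithinAt_update_same]
      have := hasDerivWithinAt_iff_tendsto_slope.1 (hwv 0 hz).1
      rw [hv0] at this
      refine this.congr fun s => ?_
      simp [slope_def_field, hw0]
    · have := (hwv t ht).1.continuousWithinAt.div continuousWithinAt_id h0.ne'
      refine this.congr_of_eventuallyEq ?_ (hft t h0)
      filter_upwards [nhdsWithin_le_nhds (Ioi_mem_nhds h0)] with s hs using hft s hs
  have hdw : ∀ t ∈ Ioo 0 T, HasDerivAt w (v t) t := fun t ht =>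
    (hwv t (Ioo_subset_Icc_self ht)).1.hasDerivAt (Icc_mem_nhds ht.1 ht.2)
  have hdv : ∀ t ∈ Ioo 0 T, HasDerivAt v (-(4 * π * t * G (f t))) t := fun t ht => by
    rw [hft t ht.1]
    exact (hwv t (Ioo_subset_Icc_self ht)).2.hasDerivAt (Icc_mem_nhds ht.1 ht.2)
  have hdf : ∀ t ∈ Ioo 0 T, HasDerivAt f ((v t - f t) / t) t := fun t ht => by
    have h0 : t ≠ 0 := ht.1.ne'
    have := (hdw t ht).div (hasDerivAt_id t) h0
    refine (this.congr_of_eventuallyEq ?_).congr_deriv ?_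
    · filter_upwards [Ioi_mem_nhds ht.1] with s hs using hft s hs
    · rw [hft t ht.1]
      simp only [id]
      field_simp
  have hflux : ∀ t ∈ Icc 0 T, t * (v t - f t) ≤ -(2 * c * t ^ 3) := by
    have hd : ∀ t ∈ Ioo 0 T, HasDerivAt (fun t => t * (v t - f t) + 2 * c * t ^ 3)
        (-(4 * π * t ^ 2 * G (f t)) + 2 * c * (3 * t ^ 2)) t := fun t ht => by
      have h0 : t ≠ 0 := ht.1.ne'
      have h1 := (hasDerivAt_id t).mul ((hdv t ht).sub (hdf t ht))
      have h2 := (hasDerivAt_pow 3 t).const_mul (2 * c)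
      refine (h1.add h2).congr_deriv ?_
      simp only [id, Pi.sub_apply]
      field_simp
      push_cast
      ring
    have ha := antitoneOn_of_hasDerivWithinAt_nonpos (convex_Icc 0 T)
      (f := fun t => t * (v t - f t) + 2 * c * t ^ 3)
      (f' := fun t => -(4 * π * t ^ 2 * G (f t)) + 2 * c * (3 * t ^ 2)) (by fun_prop)
      (fun t ht => by
        rw [interior_Icc] at ht
        exact (hd t ht).hasDerivWithinAt)
      (fun t _ => by
        have : 4 * π * t ^ 2 * η ^ p ≤ 4 * π * t ^ 2 * G (f t) := by
          gcongr
          exact hGη _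
        rw [hc]
        linarith)
    intro t ht
    have := ha hz ht ht.1
    simp only [zero_mul] at this
    norm_num at this
    linarith
  have hfle : ∀ t ∈ Icc 0 T, f t ≤ 1 - c * t ^ 2 := by
    have ha := antitoneOn_of_hasDerivWithinAt_nonpos (convex_Icc 0 T)
      (f := fun t => f t + c * t ^ 2)
      (f' := fun t => (v t - f t) / t + c * (2 * t)) (by fun_prop)
      (fun t ht => by
        rw [interior_Icc] at ht
        have h2 := (hasDerivAt_pow 2 t).const_mul c
        exact ((hdf t ht).add (by simpa using h2)).hasDerivWithinAt)
      (fun t ht => by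
        rw [interior_Icc] at ht
        have h0 := ht.1
        have h1 := hflux t (Ioo_subset_Icc_self ht)
        have h2 : (v t - f t) / t = t * (v t - f t) / t ^ 2 := by field_simp
        have h3 : t * (v t - f t) / t ^ 2 ≤ -(2 * c * t) := by
          rw [div_le_iff₀ (by positivity)]
          linarith
        rw [h2]
        linarith)
    intro t ht
    have := ha hz ht ht.1
    simp only [hf0] at this
    norm_num at this
    linarith
  have hfT : f T ≤ η := by
    have h1 := hfle T ⟨hT.le, le_rfl⟩
    have h2 : c * T = c + 1 := by simp only [T]; field_simp
    nlinarith
  have hclosed : IsCompact {t ∈ Icc 0 T | f t ≤ η} :=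
    isCompact_Icc.of_isClosed_subset
      (hcf.preimage_isClosed_of_isClosed isClosed_Icc isClosed_Iic) fun t ht => ht.1
  obtain ⟨ρ, ⟨hρ, hfρ⟩, hleast⟩ := hclosed.exists_isLeast ⟨T, ⟨hT.le, le_rfl⟩, hfT⟩
  have hρ0 : 0 < ρ := hρ.1.lt_of_ne (by rintro rfl; linarith)
  have hsub : Ico 0 ρ ⊆ Icc 0 T := fun t ht => ⟨ht.1, ht.2.le.trans hρ.2⟩
  have hlt : ∀ t ∈ Ico 0 ρ, η < f t := fun t ht => by
    by_contra! hle
    exact absurd (hleast ⟨hsub ht, hle⟩) (not_le.2 ht.2)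
  refine ⟨ρ, f, v, hρ0, ⟨hcf.mono hsub, hcv.mono hsub, fun t ht => hη.trans (hlt t ht),
    by rw [hv0, hf0], fun t ht => hdf t ⟨ht.1, ht.2.trans_le hρ.2⟩, fun t ht => ?_⟩, hf0, ?_⟩
  · have h1 : f t ≤ 1 := (hfle t (hsub (Ioo_subset_Ico_self ht))).trans (by
      have : 0 ≤ c * t ^ 2 := by positivity
      linarith)
    have h2 : G (f t) = f t ^ p := by
      simp only [G]
      rw [min_eq_left h1, max_eq_right (hlt t (Ioo_subset_Ico_self ht)).le]
    rw [← h2]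
    exact hdv t ⟨ht.1, ht.2.trans_le hρ.2⟩
  · have h1 : Tendsto f (𝓝[Ico 0 ρ] ρ) (𝓝 (f ρ)) := ((hcf ρ hρ).mono hsub).tendsto
    have h2 : ∀ᶠ t in 𝓝[Ico 0 ρ] ρ, f t < ε := h1.eventually_lt_const (hfρ.trans_lt hηε)
    have : (𝓝[Ico 0 ρ] ρ).NeBot := by
      rw [nhdsWithin_Ico_eq_nhdsLT hρ0]
      infer_instance
    obtain ⟨s, hs, hs'⟩ := (h2.and self_mem_nhdsWithin).exists
    exact ⟨s, hs', hs⟩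

variable {p T : ℝ} {f g : ℝ → ℝ}

theorem of_forall_lt (hT : 0 < T) (h : ∀ r < T, ∃ S, r < S ∧ IsRadialProfile p S f g) :
    IsRadialProfile p T f g where
  cont_f r hr := by
    obtain ⟨S, hrS, hS⟩ := h r hr.2
    exact (hS.cont_f r ⟨hr.1, hrS⟩).mono_of_mem_nhdsWithin
      (mem_nhdsWithin.2 ⟨Iio S, isOpen_Iio, hrS, fun _ hx => ⟨hx.2.1, hx.1⟩⟩)
  cont_g r hr := by
    obtain ⟨S, hrS, hS⟩ := h r hr.2
    exact (hS.cont_g r ⟨hr.1, hrS⟩).mono_of_mem_nhdsWithin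
      (mem_nhdsWithin.2 ⟨Iio S, isOpen_Iio, hrS, fun _ hx => ⟨hx.2.1, hx.1⟩⟩)
  pos r hr := by
    obtain ⟨S, hrS, hS⟩ := h r hr.2
    exact hS.pos r ⟨hr.1, hrS⟩
  zero := by
    obtain ⟨S, hrS, hS⟩ := h 0 hT
    exact hS.zero
  deriv_f r hr := by
    obtain ⟨S, hrS, hS⟩ := h r hr.2
    exact hS.deriv_f r ⟨hr.1, hrS⟩
  deriv_g r hr := by
    obtain ⟨S, hrS, hS⟩ := h r hr.2
    exact hS.deriv_g r ⟨hr.1, hrS⟩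

/-- In the subcritical range a profile reaches zero at a finite radius. -/
theorem exists_tendsto_zero (hp : 0 < p) (hp5 : p < 5) :
    ∃ T f g, 0 < T ∧ IsRadialProfile p T f g ∧ Tendsto f (𝓝[<] T) (𝓝 0) := by
  have hval : ∀ r, ∃ y z : ℝ, ∀ T f g, IsRadialProfile p T f g → f 0 = 1 → r ∈ Ico 0 T →
      f r = y ∧ g r = z := by
    intro r
    by_cases H : ∃ T f g, IsRadialProfile p T f g ∧ f 0 = 1 ∧ r ∈ Ico 0 T
    · obtain ⟨T, f, g, h, hf, hr⟩ := H
      refine ⟨f r, g r, fun T₁ f₁ g₁ h₁ hf₁ hr₁ => ?_⟩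
      have := eqOn hp (h.mono (min_le_left T T₁)) (h₁.mono (min_le_right T T₁))
        (hf₁.trans hf.symm)
      have hr' : r ∈ Ico 0 (min T T₁) := ⟨hr.1, lt_min hr.2 hr₁.2⟩
      exact ⟨this.1 hr', this.2 hr'⟩
    · exact ⟨0, 0, fun T f g h hf hr => (H ⟨T, f, g, h, hf, hr⟩).elim⟩
  choose f g hfg using hval
  set S := {T | 0 < T ∧ ∃ f g, IsRadialProfile p T f g ∧ f 0 = 1} with hS
  have hprof : ∀ T ∈ S, IsRadialProfile p T f g := by
    rintro T ⟨hT, f₁, g₁, h₁, hf₁⟩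
    exact h₁.congr hT (fun r hr => (hfg r T f₁ g₁ h₁ hf₁ hr).1.symm)
      fun r hr => (hfg r T f₁ g₁ h₁ hf₁ hr).2.symm
  have hne : S.Nonempty := by
    obtain ⟨T, f₁, g₁, hT, h₁, hf₁, -⟩ := exists_lt hp one_pos le_rfl
    exact ⟨T, hT, f₁, g₁, h₁, hf₁⟩
  have hbdd : BddAbove S := by
    by_contra hb
    refine not_global hp hp5 (f := f) (g := g) fun T => ?_
    obtain ⟨T', hT', hlt⟩ := not_bddAbove_iff.1 hb T
    exact (hprof T' hT').mono hlt.le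
  have hle : ∀ T ∈ S, T ≤ sSup S := fun T hT => le_csSup hbdd hT
  have hpos : 0 < sSup S := by
    obtain ⟨T, hT⟩ := hne
    exact hT.1.trans_le (hle T hT)
  have hmax : IsRadialProfile p (sSup S) f g := of_forall_lt hpos fun r hr => by
    obtain ⟨T, hT, hrT⟩ := exists_lt_of_lt_csSup hne hr
    exact ⟨T, hrT, hprof T hT⟩
  refine ⟨sSup S, f, g, hpos, hmax, ?_⟩
  rw [Metric.tendsto_nhds]
  intro ε hε
  obtain ⟨T, f₁, g₁, hT, h₁, hf₁, s, hs, hfs⟩ :=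
    exists_lt hp (lt_min hε one_pos) (min_le_right ε 1)
  have hsS : s < sSup S := hs.2.trans_le (hle T ⟨hT, f₁, g₁, h₁, hf₁⟩)
  filter_upwards [Ioo_mem_nhdsLT hsS] with r hr
  have hr0 : r ∈ Ico 0 (sSup S) := ⟨hs.1.trans hr.1.le, hr.2⟩
  have h1 : f r ≤ f s := hmax.antitoneOn ⟨hs.1, hsS⟩ hr0 hr.1.le
  have h2 : f₁ s = f s := (hfg s T f₁ g₁ h₁ hf₁ hs).1
  rw [Real.dist_eq, sub_zero, abs_of_pos (hmax.pos r hr0)]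
  linarith [min_le_left ε 1]

theorem le_of_tendsto_zero (hp : 0 < p) (hT : 0 < T) (h : IsRadialProfile p T f g)
    (hf : Tendsto f (𝓝[<] T) (𝓝 0)) {T₁ : ℝ} {f₁ g₁ : ℝ → ℝ}
    (h₁ : IsRadialProfile p T₁ f₁ g₁) (h0 : f₁ 0 = f 0) : T₁ ≤ T := by
  by_contra! hlt
  have heq := (eqOn hp h (h₁.mono hlt.le) h0).1
  have hmem : T ∈ Ico 0 T₁ := ⟨hT.le, hlt⟩
  have h2 : Tendsto f₁ (𝓝[<] T) (𝓝 (f₁ T)) :=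
    ((h₁.cont_f T hmem).continuousAt (Ico_mem_nhds hT hlt)).mono_left nhdsWithin_le_nhds
  have h3 : Tendsto f₁ (𝓝[<] T) (𝓝 0) := by
    refine hf.congr' ?_
    filter_upwards [Ioo_mem_nhdsLT hT] with r hr using (heq (Ioo_subset_Ico_self hr)).symm
  exact (h₁.pos T hmem).ne' (tendsto_nhds_unique h2 h3)

/-- The scaling symmetry of the Lane–Emden equation. -/
theorem scale (h : IsRadialProfile p T f g) {c μ : ℝ} (hc : 0 < c) (hμ : 0 < μ)
    (hcμ : c ^ (p - 1) = μ ^ 2) :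
    IsRadialProfile p (T / μ) (fun r => c * f (μ * r)) (fun r => c * g (μ * r)) := by
  have hmaps : MapsTo (fun r => μ * r) (Ico 0 (T / μ)) (Ico 0 T) := fun r hr =>
    ⟨mul_nonneg hμ.le hr.1, by have := (lt_div_iff₀ hμ).1 hr.2; linarith⟩
  have hmaps' : MapsTo (fun r => μ * r) (Ioo 0 (T / μ)) (Ioo 0 T) := fun r hr =>
    ⟨mul_pos hμ hr.1, by have := (lt_div_iff₀ hμ).1 hr.2; linarith⟩
  have hd (r : ℝ) : HasDerivAt (fun r => μ * r) μ r := by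
    simpa using (hasDerivAt_id r).const_mul μ
  refine ⟨continuousOn_const.mul (h.cont_f.comp (by fun_prop) hmaps),
    continuousOn_const.mul (h.cont_g.comp (by fun_prop) hmaps),
    fun r hr => mul_pos hc (h.pos _ (hmaps hr)), by simp [h.zero], fun r hr => ?_, fun r hr => ?_⟩
  · refine (((h.deriv_f _ (hmaps' hr)).comp r (hd r)).const_mul c).congr_deriv ?_
    have := hr.1.ne'
    field_simp
  · refine (((h.deriv_g _ (hmaps' hr)).comp r (hd r)).const_mul c).congr_deriv ?_
    have h1 : (c * f (μ * r)) ^ p = c * μ ^ 2 * f (μ * r) ^ p := by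
      rw [Real.mul_rpow hc.le (h.pos _ (hmaps (Ioo_subset_Ico_self hr))).le, ← hcμ,
        Real.rpow_sub_one hc.ne']
      field_simp
    rw [h1]
    ring

theorem tendsto_scale (hf : Tendsto f (𝓝[<] T) (𝓝 0)) (c : ℝ) {μ : ℝ} (hμ : 0 < μ) :
    Tendsto (fun r => c * f (μ * r)) (𝓝[<] (T / μ)) (𝓝 0) := by
  have h1 : Tendsto (fun r => μ * r) (𝓝[<] (T / μ)) (𝓝[<] T) := by
    refine tendsto_nhdsWithin_iff.2 ⟨?_, ?_⟩
    · have : Tendsto (fun r => μ * r) (𝓝 (T / μ)) (𝓝 (μ * (T / μ))) :=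
        (continuous_const.mul continuous_id).tendsto _
      rw [mul_div_cancel₀ _ hμ.ne'] at this
      exact this.mono_left nhdsWithin_le_nhds
    · filter_upwards [self_mem_nhdsWithin] with r hr
      have := (lt_div_iff₀ hμ).1 hr
      simp only [mem_Iio]
      linarith
  simpa using (hf.comp h1).const_mul c

theorem exists_radius (hp : 0 < p) (hp5 : p < 5) (hp1 : p ≠ 1) {R : ℝ} (hR : 0 < R) :
    ∃ f g, IsRadialProfile p R f g ∧ Tendsto f (𝓝[<] R) (𝓝 0) := by
  obtain ⟨T, f, g, hT, h, hf⟩ := exists_tendsto_zero hp hp5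
  have hμ : 0 < T / R := div_pos hT hR
  have hc : 0 < (T / R) ^ (2 / (p - 1)) := Real.rpow_pos_of_pos hμ _
  have hcμ : ((T / R) ^ (2 / (p - 1))) ^ (p - 1) = (T / R) ^ 2 := by
    rw [← Real.rpow_mul hμ.le, div_mul_cancel₀ _ (sub_ne_zero.2 hp1), Real.rpow_two]
  have hTR : T / (T / R) = R := by field_simp
  have h1 := h.scale hc hμ hcμ
  have h2 := tendsto_scale hf ((T / R) ^ (2 / (p - 1))) hμ
  rw [hTR] at h1 h2
  exact ⟨_, _, h1, h2⟩

theorem eqOn_of_tendsto_zero (hp : 0 < p) (hp1 : p ≠ 1) (hT : 0 < T)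
    (h : IsRadialProfile p T f g) (hf : Tendsto f (𝓝[<] T) (𝓝 0)) {f₁ g₁ : ℝ → ℝ}
    (h₁ : IsRadialProfile p T f₁ g₁) (hf₁ : Tendsto f₁ (𝓝[<] T) (𝓝 0)) :
    EqOn f₁ f (Ico 0 T) := by
  have hz : (0 : ℝ) ∈ Ico 0 T := ⟨le_rfl, hT⟩
  set c := f 0 / f₁ 0
  have hf0 := h.pos 0 hz
  have hf₁0 := h₁.pos 0 hz
  have hc : 0 < c := div_pos hf0 hf₁0
  set μ := c ^ ((p - 1) / 2)
  have hμ : 0 < μ := Real.rpow_pos_of_pos hc _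
  have hcμ : c ^ (p - 1) = μ ^ 2 := by
    rw [← Real.rpow_two, ← Real.rpow_mul hc.le, div_mul_cancel₀ _ two_ne_zero]
  have h2 := h₁.scale hc hμ hcμ
  have ht2 := tendsto_scale hf₁ c hμ
  have h0 : c * f₁ (μ * 0) = f 0 := by
    rw [mul_zero]
    exact div_mul_cancel₀ _ hf₁0.ne'
  have hle := le_of_tendsto_zero hp hT h hf h2 h0
  have hge := le_of_tendsto_zero hp (div_pos hT hμ) h2 ht2 h h0.symm
  have hμ1 : μ = 1 := by
    have : T / μ = T := le_antisymm hle hge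
    rw [div_eq_iff hμ.ne'] at this
    exact mul_left_cancel₀ hT.ne' (by linarith)
  have hc1 : c = 1 := by
    have h3 : log μ = (p - 1) / 2 * log c := Real.log_rpow hc _
    rw [hμ1, log_one] at h3
    have h4 : log c = 0 := by
      rcases mul_eq_zero.1 h3.symm with h5 | h5
      · exact (hp1 (by linarith)).elim
      · exact h5
    exact Real.eq_one_of_pos_of_log_eq_zero hc h4
  refine (eqOn hp h h₁ ?_).1
  rw [hc1, one_mul, mul_zero] at h0
  exact h0

end IsRadialProfile

section RadialCalculus

variable {E : Type*} [NormedAddCommGroup E] [InnerProductSpace ℝ E]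

/-- The real inner product as a continuous bilinear map. -/
noncomputable def innerCLM : E →L[ℝ] E →L[ℝ] ℝ := innerSL ℝ

@[simp] theorem innerCLM_apply (x y : E) : innerCLM x y = inner ℝ x y := rfl

theorem hasFDerivAt_norm_of_ne_zero {x : E} (hx : x ≠ 0) :
    HasFDerivAt (fun y : E => ‖y‖) (‖x‖⁻¹ • innerCLM x) x := by
  have hn : ‖x‖ ≠ 0 := norm_ne_zero_iff.2 hx
  have h := (hasStrictFDerivAt_norm_sq x).hasFDerivAt.sqrt (pow_ne_zero 2 hn)
  simp only [Real.sqrt_sq (norm_nonneg _)] at h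
  refine h.congr_fderiv ?_
  ext y
  simp
  field_simp

theorem hasFDerivAt_comp_norm {f : ℝ → ℝ} {q : ℝ} {x : E} (hx : x ≠ 0)
    (hf : HasDerivAt f (‖x‖ * q) ‖x‖) :
    HasFDerivAt (fun y : E => f ‖y‖) (q • innerCLM x) x := by
  have hn : ‖x‖ ≠ 0 := norm_ne_zero_iff.2 hx
  refine (hf.comp_hasFDerivAt x (hasFDerivAt_norm_of_ne_zero hx)).congr_fderiv ?_
  rw [smul_smul]
  congr 1
  field_simp

theorem hasFDerivAt_smul_innerCLM {q : ℝ → ℝ} {q' : ℝ} {x : E} (hx : x ≠ 0)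
    (hq : HasDerivAt q q' ‖x‖) :
    HasFDerivAt (fun y : E => q ‖y‖ • innerCLM y)
      (q ‖x‖ • (innerCLM : E →L[ℝ] E →L[ℝ] ℝ)
        + (q' / ‖x‖) • (innerCLM x).smulRight (innerCLM x)) x := by
  have h1 := hq.comp_hasFDerivAt x (hasFDerivAt_norm_of_ne_zero hx)
  have h2 := h1.smul ((innerCLM : E →L[ℝ] E →L[ℝ] ℝ).hasFDerivAt (x := x))
  refine h2.congr_fderiv ?_
  ext y z
  simp
  ring

theorem hasFDerivAt_comp_norm_zero {f : ℝ → ℝ} (hf : HasDerivWithinAt f 0 (Ici 0) 0) :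
    HasFDerivAt (fun y : E => f ‖y‖) (0 : E →L[ℝ] ℝ) 0 := by
  rw [hasFDerivAt_iff_isLittleO]
  have h := hasDerivWithinAt_iff_isLittleO.1 hf
  have ht : Tendsto (fun y : E => ‖y‖) (𝓝 0) (𝓝[Ici 0] 0) :=
    tendsto_nhdsWithin_iff.2 ⟨tendsto_norm_zero, Eventually.of_forall fun y => norm_nonneg y⟩
  have := h.comp_tendsto ht
  simp only [Function.comp_def, sub_zero, smul_zero] at this
  simpa using Asymptotics.isLittleO_norm_right.1 this

theorem hasFDerivAt_smul_innerCLM_zero {q : ℝ → ℝ} (hq : ContinuousWithinAt q (Ici 0) 0) :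
    HasFDerivAt (fun y : E => q ‖y‖ • innerCLM y)
      (q 0 • (innerCLM : E →L[ℝ] E →L[ℝ] ℝ)) 0 := by
  rw [hasFDerivAt_iff_isLittleO]
  have ht : Tendsto (fun y : E => ‖y‖) (𝓝 0) (𝓝[Ici 0] 0) :=
    tendsto_nhdsWithin_iff.2 ⟨tendsto_norm_zero, Eventually.of_forall fun y => norm_nonneg y⟩
  have h1 : Tendsto (fun y : E => q ‖y‖ - q 0) (𝓝 0) (𝓝 0) := by
    simpa using (hq.tendsto.comp ht).sub_const (q 0)
  have h2 := ((Asymptotics.isLittleO_one_iff ℝ).2 h1).smul_isBigO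
    ((innerCLM : E →L[ℝ] E →L[ℝ] ℝ).isBigO_id (𝓝 0))
  refine (h2.congr (fun y => ?_) (fun y => ?_))
  · ext z
    simp [sub_mul]
  · simp

theorem contDiffOn_two_of_hasFDerivAt {s : Set E} (hs : IsOpen s) {u : E → ℝ}
    {F : E → E →L[ℝ] ℝ} {B : E → E →L[ℝ] E →L[ℝ] ℝ} (h1 : ∀ x ∈ s, HasFDerivAt u (F x) x)
    (h2 : ∀ x ∈ s, HasFDerivAt F (B x) x) (h3 : ContinuousOn B s) : ContDiffOn ℝ 2 u s := by
  have hF : ContDiffOn ℝ 1 F s := by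
    rw [show (1 : WithTop ℕ∞) = 0 + 1 by norm_num,
      contDiffOn_succ_iff_hasFDerivWithinAt_of_uniqueDiffOn hs.uniqueDiffOn]
    exact ⟨by simp, B, contDiffOn_zero.2 h3, fun x hx => (h2 x hx).hasFDerivWithinAt⟩
  rw [show (2 : WithTop ℕ∞) = 1 + 1 by norm_num,
    contDiffOn_succ_iff_hasFDerivWithinAt_of_uniqueDiffOn hs.uniqueDiffOn]
  exact ⟨by simp, F, hF, fun x hx => (h1 x hx).hasFDerivWithinAt⟩

end RadialCalculus

theorem lap_eq_sum {u : EuclideanSpace ℝ (Fin 3) → ℝ} {x : EuclideanSpace ℝ (Fin 3)}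
    {F : EuclideanSpace ℝ (Fin 3) → EuclideanSpace ℝ (Fin 3) →L[ℝ] ℝ}
    {B : EuclideanSpace ℝ (Fin 3) →L[ℝ] EuclideanSpace ℝ (Fin 3) →L[ℝ] ℝ}
    (h1 : ∀ᶠ y in 𝓝 x, HasFDerivAt u (F y) y) (h2 : HasFDerivAt F B x) :
    lap u x = ∑ i : Fin 3, B (EuclideanSpace.single i 1) (EuclideanSpace.single i 1) := by
  have h3 : fderiv ℝ u =ᶠ[𝓝 x] F := h1.mono fun y hy => hy.fderiv
  simp [lap, iteratedFDeriv_two_apply, h3.fderiv_eq, h2.fderiv]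

theorem sum_radial_hessian (a b : ℝ) (x : EuclideanSpace ℝ (Fin 3)) :
    ∑ i : Fin 3,
      (a • (innerCLM : EuclideanSpace ℝ (Fin 3) →L[ℝ] EuclideanSpace ℝ (Fin 3) →L[ℝ] ℝ)
        + b • (innerCLM x).smulRight (innerCLM x))
      (EuclideanSpace.single i 1) (EuclideanSpace.single i 1) = 3 * a + b * ‖x‖ ^ 2 := by
  simp [EuclideanSpace.norm_sq_eq, Fin.sum_univ_three, EuclideanSpace.inner_single_right]
  ring

theorem continuousOn_comp_norm {E : Type*} [SeminormedAddCommGroup E] {f : ℝ → ℝ} {T : ℝ}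
    (hf : ContinuousOn f (Ico 0 T)) : ContinuousOn (fun x : E => f ‖x‖) (Metric.ball 0 T) :=
  hf.comp continuous_norm.continuousOn fun x hx => ⟨norm_nonneg x, mem_ball_zero_iff.1 hx⟩

section RadialHessian

variable {E : Type*} [NormedAddCommGroup E] [InnerProductSpace ℝ E]

/-- The Hessian of the radial function `x ↦ f ‖x‖`, where `f' r = r * q r` and
`q' r = k r / r`. -/
noncomputable def radialHessian (q k : ℝ → ℝ) (x : E) : E →L[ℝ] E →L[ℝ] ℝ :=
  q ‖x‖ • innerCLM + (k ‖x‖ / ‖x‖ / ‖x‖) • (innerCLM x).smulRight (innerCLM x)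

theorem norm_rankOne_le (k : ℝ → ℝ) (x : E) :
    ‖(k ‖x‖ / ‖x‖ / ‖x‖) • (innerCLM x).smulRight (innerCLM x)‖ ≤ ‖k ‖x‖‖ := by
  have hx : ‖(innerCLM x : E →L[ℝ] ℝ)‖ = ‖x‖ := innerSL_apply_norm ℝ x
  refine (ContinuousLinearMap.opNorm_smul_le _ _).trans ?_
  rw [ContinuousLinearMap.norm_smulRight_apply, hx]
  rcases (norm_nonneg x).eq_or_lt with h | h
  · rw [← h]; simp
  · rw [norm_div, norm_div, norm_norm]
    field_simp
    rfl

set_option maxSynthPendingDepth 5 in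
theorem continuousOn_radialHessian {q k : ℝ → ℝ} {T : ℝ} (hq : ContinuousOn q (Ico 0 T))
    (hk : ContinuousOn k (Ico 0 T)) (hk0 : k 0 = 0) :
    ContinuousOn (radialHessian q k : E → E →L[ℝ] E →L[ℝ] ℝ) (Metric.ball 0 T) := by
  have hk' := continuousOn_comp_norm (E := E) hk
  have hq' := continuousOn_comp_norm (E := E) hq
  have hc : ContinuousOn (fun _ : E => (innerCLM : E →L[ℝ] E →L[ℝ] ℝ)) (Metric.ball 0 T) :=
    continuousOn_const
  refine (hq'.smul hc).add fun x hx => ?_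
  rcases eq_or_ne x 0 with rfl | h0
  · have h1 : Tendsto (fun x : E => ‖k ‖x‖‖) (𝓝[Metric.ball 0 T] 0) (𝓝 0) := by
      simpa [hk0] using (hk' 0 hx).norm.tendsto
    have := squeeze_zero_norm (fun x => norm_rankOne_le k x) h1
    simpa [ContinuousWithinAt] using this
  · have hn : ‖x‖ ≠ 0 := norm_ne_zero_iff.2 h0
    have h2 : Continuous fun x : E => (innerCLM x).smulRight (innerCLM x) := by
      have := (ContinuousLinearMap.smulRightL ℝ E (E →L[ℝ] ℝ)).isBoundedBilinearMap.continuous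
      exact this.comp
        ((innerCLM : E →L[ℝ] E →L[ℝ] ℝ).continuous.prodMk (innerCLM : E →L[ℝ] E →L[ℝ] ℝ).continuous)
    exact (((hk' x hx).div continuous_norm.continuousWithinAt hn).div
      continuous_norm.continuousWithinAt hn).smul h2.continuousWithinAt

variable {f q k : ℝ → ℝ} {T : ℝ}

theorem hasFDerivAt_radial (hf0 : HasDerivWithinAt f 0 (Ici 0) 0)
    (hf : ∀ r ∈ Ioo 0 T, HasDerivAt f (r * q r) r) {x : E} (hx : x ∈ Metric.ball 0 T) :
    HasFDerivAt (fun y : E => f ‖y‖) (q ‖x‖ • innerCLM x) x := by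
  rcases eq_or_ne x 0 with rfl | h0
  · simpa using hasFDerivAt_comp_norm_zero (E := E) hf0
  · exact hasFDerivAt_comp_norm h0 (hf _ ⟨norm_pos_iff.2 h0, mem_ball_zero_iff.1 hx⟩)

theorem hasFDerivAt_radial_gradient (hq : ContinuousOn q (Ico 0 T))
    (hq' : ∀ r ∈ Ioo 0 T, HasDerivAt q (k r / r) r) {x : E} (hx : x ∈ Metric.ball 0 T) :
    HasFDerivAt (fun y : E => q ‖y‖ • (innerCLM y : E →L[ℝ] ℝ)) (radialHessian q k x) x := by
  have hT := mem_ball_zero_iff.1 hx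
  rcases eq_or_ne x 0 with rfl | h0
  · rw [norm_zero] at hT
    have h1 : ContinuousWithinAt q (Ici 0) 0 :=
      (hq 0 ⟨le_rfl, hT⟩).mono_of_mem_nhdsWithin (Ico_mem_nhdsGE hT)
    refine (hasFDerivAt_smul_innerCLM_zero (E := E) h1).congr_fderiv ?_
    ext y z
    simp [radialHessian]
  · exact hasFDerivAt_smul_innerCLM h0 (hq' _ ⟨norm_pos_iff.2 h0, hT⟩)

theorem contDiffOn_radial (hf0 : HasDerivWithinAt f 0 (Ici 0) 0)
    (hf : ∀ r ∈ Ioo 0 T, HasDerivAt f (r * q r) r) (hq : ContinuousOn q (Ico 0 T))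
    (hq' : ∀ r ∈ Ioo 0 T, HasDerivAt q (k r / r) r) (hk : ContinuousOn k (Ico 0 T))
    (hk0 : k 0 = 0) : ContDiffOn ℝ 2 (fun x : E => f ‖x‖) (Metric.ball 0 T) :=
  contDiffOn_two_of_hasFDerivAt Metric.isOpen_ball (fun _ hx => hasFDerivAt_radial hf0 hf hx)
    (fun _ hx => hasFDerivAt_radial_gradient hq hq' hx) (continuousOn_radialHessian hq hk hk0)

end RadialHessian

theorem lap_radial {f q k : ℝ → ℝ} {T : ℝ} (hf0 : HasDerivWithinAt f 0 (Ici 0) 0)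
    (hf : ∀ r ∈ Ioo 0 T, HasDerivAt f (r * q r) r) (hq : ContinuousOn q (Ico 0 T))
    (hq' : ∀ r ∈ Ioo 0 T, HasDerivAt q (k r / r) r)
    (hk0 : k 0 = 0) {x : EuclideanSpace ℝ (Fin 3)} (hx : x ∈ Metric.ball 0 T) :
    lap (fun y => f ‖y‖) x = 3 * q ‖x‖ + k ‖x‖ := by
  rw [lap_eq_sum (eventually_of_mem (Metric.isOpen_ball.mem_nhds hx) fun y hy =>
    hasFDerivAt_radial hf0 hf hy) (hasFDerivAt_radial_gradient hq hq' hx), radialHessian,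
    sum_radial_hessian]
  rcases eq_or_ne x 0 with rfl | h0
  · simp [hk0]
  · have hn : ‖x‖ ≠ 0 := norm_ne_zero_iff.2 h0
    field_simp

namespace IsRadialProfile

variable {p T : ℝ} {f g : ℝ → ℝ}

/-- The continuous extension to `0` of the quotient `f' r / r` of a radial profile. -/
noncomputable def slopeQuotient (p : ℝ) (f g : ℝ → ℝ) : ℝ → ℝ :=
  Function.update (fun r => (g r - f r) / r ^ 2) 0 (-(4 * π / 3 * f 0 ^ p))

theorem slopeQuotient_of_ne_zero {r : ℝ} (hr : r ≠ 0) :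
    slopeQuotient p f g r = (g r - f r) / r ^ 2 :=
  Function.update_of_ne hr _ _

theorem slopeQuotient_zero : slopeQuotient p f g 0 = -(4 * π / 3 * f 0 ^ p) :=
  Function.update_self ..

theorem continuousOn_rpow (h : IsRadialProfile p T f g) :
    ContinuousOn (fun r => f r ^ p) (Ico 0 T) :=
  h.cont_f.rpow_const fun r hr => Or.inl (h.pos r hr).ne'

theorem tendsto_slopeQuotient (h : IsRadialProfile p T f g) (hT : 0 < T) :
    Tendsto (fun r => (g r - f r) / r ^ 2) (𝓝[>] 0) (𝓝 (-(4 * π / 3 * f 0 ^ p))) := by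
  have hIoo : Ioo 0 T ∈ 𝓝[>] (0 : ℝ) := Ioo_mem_nhdsGT hT
  have h0 : (0 : ℝ) ∈ Ico 0 T := ⟨le_rfl, hT⟩
  have hle : 𝓝[>] (0 : ℝ) ≤ 𝓝[Ico 0 T] 0 :=
    (nhdsWithin_mono _ Ioi_subset_Ici_self).trans
      (nhdsWithin_le_of_mem (Ico_mem_nhdsGE hT))
  have hflux : Tendsto (fun r => r * (g r - f r)) (𝓝[>] 0) (𝓝 0) := by
    simpa using (h.cont_flux 0 h0).tendsto.mono_left hle
  have hcube : Tendsto (fun r : ℝ => r ^ 3) (𝓝[>] 0) (𝓝 0) := by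
    simpa using ((continuous_pow 3).tendsto (0 : ℝ)).mono_left nhdsWithin_le_nhds
  have hpow := ((h.continuousOn_rpow 0 h0).tendsto.mono_left hle).const_mul (-(4 * π / 3))
  have := HasDerivAt.lhopital_zero_nhdsGT
    (f := fun r => r * (g r - f r)) (f' := fun r => -(4 * π * r ^ 2 * f r ^ p))
    (g := fun r => r ^ 3) (g' := fun r => 3 * r ^ 2)
    (eventually_of_mem hIoo fun r hr => h.deriv_flux hr)
    (Eventually.of_forall fun r => by simpa using hasDerivAt_pow 3 r)
    (eventually_of_mem hIoo fun r hr => by have := hr.1; positivity) hflux hcube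
    (l := 𝓝 (-(4 * π / 3 * f 0 ^ p))) ?_
  · refine this.congr' (eventually_of_mem hIoo fun r hr => ?_)
    have := hr.1.ne'
    field_simp
  · rw [neg_mul] at hpow
    refine hpow.congr' (eventually_of_mem hIoo fun r hr => ?_)
    have := hr.1.ne'
    field_simp

theorem continuousOn_slopeQuotient (h : IsRadialProfile p T f g) (hT : 0 < T) :
    ContinuousOn (slopeQuotient p f g) (Ico 0 T) := by
  refine continuousOn_update_iff.2 ⟨?_, fun _ => ?_⟩
  · exact ((h.cont_g.sub h.cont_f).mono sdiff_subset).div (continuous_pow 2).continuousOn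
      fun r hr => pow_ne_zero 2 hr.2
  · refine (h.tendsto_slopeQuotient hT).mono_left (nhdsWithin_mono _ ?_)
    exact fun r hr => hr.1.1.lt_of_ne (Ne.symm hr.2)

theorem hasDerivAt_slope (h : IsRadialProfile p T f g) :
    ∀ r ∈ Ioo 0 T, HasDerivAt f (r * slopeQuotient p f g r) r := by
  intro r hr
  have hr0 := hr.1.ne'
  convert! h.deriv_f r hr using 1
  rw [slopeQuotient_of_ne_zero hr0]
  field_simp

theorem hasDerivAt_slopeQuotient (h : IsRadialProfile p T f g) :
    ∀ r ∈ Ioo 0 T, HasDerivAt (slopeQuotient p f g)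
      ((-(4 * π * f r ^ p) - 3 * slopeQuotient p f g r) / r) r := by
  intro r hr
  have hr0 := hr.1.ne'
  have h1 := (h.deriv_flux hr).div (hasDerivAt_pow 3 r) (pow_ne_zero 3 hr0)
  have h2 : slopeQuotient p f g =ᶠ[𝓝 r] fun r => r * (g r - f r) / r ^ 3 := by
    filter_upwards [isOpen_ne.mem_nhds hr0] with s hs
    rw [slopeQuotient_of_ne_zero hs]
    have : s ≠ 0 := hs
    field_simp
  convert! h1.congr_of_eventuallyEq h2 using 1
  rw [slopeQuotient_of_ne_zero hr0]
  field_simp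
  ring

theorem hasDerivWithinAt_zero (h : IsRadialProfile p T f g) (hT : 0 < T) :
    HasDerivWithinAt f 0 (Ici 0) 0 := by
  have hIoo : Ioo 0 T ∈ 𝓝[>] (0 : ℝ) := Ioo_mem_nhdsGT hT
  refine hasDerivWithinAt_Ici_of_tendsto_deriv (s := Ioo 0 T)
    (fun r hr => (h.hasDerivAt_slope r hr).differentiableAt.differentiableWithinAt)
    ((h.cont_f 0 ⟨le_rfl, hT⟩).mono Ioo_subset_Ico_self) hIoo ?_
  have h1 := (tendsto_id.mono_left nhdsWithin_le_nhds : Tendsto id (𝓝[>] (0 : ℝ)) (𝓝 0)).mul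
    (h.tendsto_slopeQuotient hT)
  rw [zero_mul] at h1
  refine h1.congr' (eventually_of_mem hIoo fun r hr => ?_)
  simp only
  rw [(h.hasDerivAt_slope r hr).deriv, slopeQuotient_of_ne_zero hr.1.ne', id]

theorem isLaneEmdenSolution (h : IsRadialProfile p T f g) (hT : 0 < T)
    (hf : Tendsto f (𝓝[<] T) (𝓝 0)) :
    IsLaneEmdenSolution p T (fun x => if ‖x‖ < T then f ‖x‖ else 0) := by
  have hq := h.continuousOn_slopeQuotient hT
  have hk : ContinuousOn (fun r => -(4 * π * f r ^ p) - 3 * slopeQuotient p f g r) (Ico 0 T) :=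
    (continuousOn_const.mul h.continuousOn_rpow).neg.sub (continuousOn_const.mul hq)
  have hk0 : -(4 * π * f 0 ^ p) - 3 * slopeQuotient p f g 0 = 0 := by
    rw [slopeQuotient_zero]; ring
  have heq : EqOn (fun x : EuclideanSpace ℝ (Fin 3) => if ‖x‖ < T then f ‖x‖ else 0)
      (fun x => f ‖x‖) (Metric.ball 0 T) := fun x hx => if_pos (mem_ball_zero_iff.1 hx)
  refine ⟨?_, ?_, ?_, ?_, ?_, ?_⟩
  · rw [closure_ball _ hT.ne']
    have hc : ContinuousOn (fun r => if r < T then f r else 0) (Icc 0 T) := by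
      intro r hr
      rcases hr.2.eq_or_lt with rfl | hrT
      · have h1 : Tendsto (fun s => if s < r then f s else 0) (𝓝[<] r) (𝓝 0) :=
          hf.congr' (eventually_of_mem self_mem_nhdsWithin fun s hs => (if_pos hs).symm)
        have h2 : ContinuousWithinAt (fun s => if s < r then f s else 0) (Iio r) r := by
          simpa [ContinuousWithinAt] using h1
        exact (continuousWithinAt_Iio_iff_Iic.1 h2).mono Icc_subset_Iic_self
      · have h1 : ContinuousWithinAt f (Icc 0 T) r := by
          refine (h.cont_f r ⟨hr.1, hrT⟩).mono_of_mem_nhdsWithin ?_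
          filter_upwards [self_mem_nhdsWithin, mem_nhdsWithin_of_mem_nhds (Iio_mem_nhds hrT)]
            with s hs hs' using ⟨hs.1, hs'⟩
        refine h1.congr_of_eventuallyEq ?_ (if_pos hrT)
        filter_upwards [mem_nhdsWithin_of_mem_nhds (Iio_mem_nhds hrT)] with s hs using if_pos hs
    exact hc.comp continuous_norm.continuousOn fun x hx =>
      ⟨norm_nonneg x, mem_closedBall_zero_iff.1 hx⟩
  · exact (contDiffOn_radial (h.hasDerivWithinAt_zero hT) h.hasDerivAt_slope hq
      h.hasDerivAt_slopeQuotient hk hk0).congr heq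
  · intro x _ y _ hxy
    simp only [hxy]
  · intro x hx
    rw [heq hx]
    exact h.pos _ ⟨norm_nonneg x, mem_ball_zero_iff.1 hx⟩
  · intro x hx
    exact if_neg (mem_sphere_zero_iff_norm.1 hx).not_lt
  · intro x hx
    have h1 := (heq.eventuallyEq_of_mem (Metric.isOpen_ball.mem_nhds hx)).iteratedFDeriv ℝ 2
    have h2 : lap (fun x => if ‖x‖ < T then f ‖x‖ else 0) x = lap (fun x => f ‖x‖) x := by
      simp only [lap, h1.eq_of_nhds]
    rw [h2, lap_radial (h.hasDerivWithinAt_zero hT) h.hasDerivAt_slope hq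
      h.hasDerivAt_slopeQuotient hk0 hx]
    simp only [if_pos (mem_ball_zero_iff.1 hx)]
    ring

end IsRadialProfile

namespace IsLaneEmdenSolution

variable {p R : ℝ} {v : EuclideanSpace ℝ (Fin 3) → ℝ}

/-- The restriction of `v` to the first coordinate axis. -/
noncomputable def axis (v : EuclideanSpace ℝ (Fin 3) → ℝ) (r : ℝ) : ℝ :=
  v (r • EuclideanSpace.single 0 1)

theorem norm_smul_axis (r : ℝ) :
    ‖r • (EuclideanSpace.single 0 1 : EuclideanSpace ℝ (Fin 3))‖ = |r| := by
  simp [norm_smul]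

theorem smul_axis_mem_ball {r : ℝ} (hr : |r| < R) :
    r • (EuclideanSpace.single 0 1 : EuclideanSpace ℝ (Fin 3)) ∈ Metric.ball 0 R := by
  rwa [mem_ball_zero_iff, norm_smul_axis]

theorem eq_axis (h : IsLaneEmdenSolution p R v) {x : EuclideanSpace ℝ (Fin 3)}
    (hx : x ∈ Metric.ball 0 R) : v x = axis v ‖x‖ := by
  refine h.2.2.1 x hx _ (smul_axis_mem_ball ?_) ?_
  · rw [abs_norm]; exact mem_ball_zero_iff.1 hx
  · rw [norm_smul_axis, abs_norm]

theorem contDiffOn_axis (h : IsLaneEmdenSolution p R v) :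
    ContDiffOn ℝ 2 (axis v) (Ioo (-R) R) :=
  h.2.1.comp (contDiff_id.smul contDiff_const).contDiffOn fun _ hr =>
    smul_axis_mem_ball (abs_lt.2 hr)

theorem contDiffOn_deriv_axis (h : IsLaneEmdenSolution p R v) :
    ContDiffOn ℝ 1 (deriv (axis v)) (Ioo (-R) R) := by
  have := h.contDiffOn_axis
  rw [show (2 : WithTop ℕ∞) = 1 + 1 by norm_num,
    contDiffOn_succ_iff_deriv_of_isOpen isOpen_Ioo] at this
  exact this.2.2

theorem hasDerivAt_axis (h : IsLaneEmdenSolution p R v) {r : ℝ} (hr : r ∈ Ioo (-R) R) :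
    HasDerivAt (axis v) (deriv (axis v) r) r :=
  ((h.contDiffOn_axis.differentiableOn (by norm_num)).differentiableAt
    (isOpen_Ioo.mem_nhds hr)).hasDerivAt

theorem hasDerivAt_deriv_axis (h : IsLaneEmdenSolution p R v) {r : ℝ} (hr : r ∈ Ioo (-R) R) :
    HasDerivAt (deriv (axis v)) (deriv (deriv (axis v)) r) r :=
  ((h.contDiffOn_deriv_axis.differentiableOn (by norm_num)).differentiableAt
    (isOpen_Ioo.mem_nhds hr)).hasDerivAt

theorem radial_equation (h : IsLaneEmdenSolution p R v) {r : ℝ} (hr : r ∈ Ioo 0 R) :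
    2 * deriv (axis v) r + r * deriv (deriv (axis v)) r = -(4 * π * r * axis v r ^ p) := by
  have hsub : Ioo 0 R ⊆ Ioo (-R) R := Ioo_subset_Ioo_left (by linarith [hr.1, hr.2])
  set x : EuclideanSpace ℝ (Fin 3) := r • EuclideanSpace.single 0 1 with hx
  have hr0 : r ≠ 0 := hr.1.ne'
  have hnx : ‖x‖ = r := by rw [hx, norm_smul_axis, abs_of_pos hr.1]
  have hxB : x ∈ Metric.ball 0 R := by rw [mem_ball_zero_iff, hnx]; exact hr.2
  have hx0 : x ≠ 0 := norm_ne_zero_iff.1 (hnx ▸ hr0)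
  have h1 : ∀ᶠ y in 𝓝 x, HasFDerivAt v ((fun s => deriv (axis v) s / s) ‖y‖ • innerCLM y) y := by
    filter_upwards [Metric.isOpen_ball.mem_nhds hxB, isOpen_ne.mem_nhds hx0] with y hy hy0
    have hn := norm_pos_iff.2 hy0
    have hd := h.hasDerivAt_axis (hsub ⟨hn, mem_ball_zero_iff.1 hy⟩)
    refine (hasFDerivAt_comp_norm hy0 (f := axis v) ?_).congr_of_eventuallyEq ?_
    · convert! hd using 1
      field_simp
    · filter_upwards [Metric.isOpen_ball.mem_nhds hy] with z hz using h.eq_axis hz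
  have hq : HasDerivAt (fun s => deriv (axis v) s / s) _ ‖x‖ :=
    (h.hasDerivAt_deriv_axis (by rw [hnx]; exact hsub hr)).div (hasDerivAt_id _)
      (by rw [hnx]; exact hr0)
  have h2 := lap_eq_sum h1 (hasFDerivAt_smul_innerCLM hx0 hq)
  rw [sum_radial_hessian, hnx] at h2
  have h3 := h.2.2.2.2.2 x hxB
  rw [h2] at h3
  have h4 : axis v r = v x := rfl
  rw [h4]
  field_simp at h3 ⊢
  linarith

theorem isRadialProfile (h : IsLaneEmdenSolution p R v) (hR : 0 < R) :
    IsRadialProfile p R (axis v) (fun r => axis v r + r * deriv (axis v) r) where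
  cont_f := h.contDiffOn_axis.continuousOn.mono fun r hr => ⟨by linarith [hr.1], hr.2⟩
  cont_g := (h.contDiffOn_axis.continuousOn.add
    (continuousOn_id.mul h.contDiffOn_deriv_axis.continuousOn)).mono
      fun r hr => ⟨by linarith [hr.1], hr.2⟩
  pos r hr := h.2.2.2.1 _ (smul_axis_mem_ball (by rw [abs_of_nonneg hr.1]; exact hr.2))
  zero := by simp
  deriv_f r hr := by
    have hr0 := hr.1.ne'
    convert! h.hasDerivAt_axis (r := r) ⟨by linarith [hr.1], hr.2⟩ using 1
    field_simp
    ring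
  deriv_g r hr := by
    have hr' : r ∈ Ioo (-R) R := ⟨by linarith [hr.1], hr.2⟩
    have := (h.hasDerivAt_axis hr').add ((hasDerivAt_id r).mul (h.hasDerivAt_deriv_axis hr'))
    convert! this using 1
    rw [← h.radial_equation hr, id]
    ring

theorem tendsto_axis (h : IsLaneEmdenSolution p R v) (hR : 0 < R) :
    Tendsto (axis v) (𝓝[<] R) (𝓝 0) := by
  have h1 := h.1
  rw [closure_ball _ hR.ne'] at h1
  have h2 : ContinuousOn (axis v) (Icc 0 R) :=
    h1.comp (continuous_id.smul continuous_const).continuousOn fun r hr => by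
      rw [mem_closedBall_zero_iff, norm_smul_axis, abs_of_nonneg hr.1]
      exact hr.2
  have h3 : axis v R = 0 := h.2.2.2.2.1 _ (by
    rw [mem_sphere_zero_iff_norm, norm_smul_axis, abs_of_pos hR])
  have h4 := (h2 R ⟨hR.le, le_rfl⟩).tendsto.mono_left
    ((nhdsWithin_le_of_mem (Ioo_mem_nhdsLT hR)).trans (nhdsWithin_mono _ Ioo_subset_Icc_self))
  rwa [h3] at h4

end IsLaneEmdenSolution

/-- For `0 < p < 5`, `p ≠ 1`, on every finite ball there is exactly one positive radial
Dirichlet solution of the Lane–Emden equation `Δu + 4π u^p = 0` (uniqueness being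
uniqueness of the values on the closed ball). -/
theorem lane_emden_exists_unique (p : ℝ) (hp0 : 0 < p) (hp5 : p < 5) (hp1 : p ≠ 1)
    (R : ℝ) (hR : 0 < R) :
    ∃ u : EuclideanSpace ℝ (Fin 3) → ℝ, IsLaneEmdenSolution p R u ∧
      ∀ v : EuclideanSpace ℝ (Fin 3) → ℝ, IsLaneEmdenSolution p R v →
        Set.EqOn v u (closure (Metric.ball (0 : EuclideanSpace ℝ (Fin 3)) R)) := by
  obtain ⟨f, g, h, hf⟩ := IsRadialProfile.exists_radius hp0 hp5 hp1 hR
  refine ⟨_, h.isLaneEmdenSolution hR hf, fun v hv x hx => ?_⟩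
  rw [closure_ball _ hR.ne', mem_closedBall_zero_iff] at hx
  rcases hx.lt_or_eq with hlt | heq
  · rw [hv.eq_axis (mem_ball_zero_iff.2 hlt), if_pos hlt]
    exact IsRadialProfile.eqOn_of_tendsto_zero hp0 hp1 hR h hf (hv.isRadialProfile hR)
      (hv.tendsto_axis hR) ⟨norm_nonneg x, hlt⟩
  · rw [hv.2.2.2.2.1 x (mem_sphere_zero_iff_norm.2 heq), if_neg heq.not_lt]
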